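/- Let X and Y be Archimedean vector lattices with X uniformly complete, and let T : X → Y be a positive linear map (T(x) ≥ 0 whenever x ≥ 0). Let X′ ⊆ X and Y′ ⊆ Y be sublattices with Y′ uniformly complete as a vector lattice in its own right, and let X̄′ denote the uniform closure of X′ in X, i.e., the intersection of all sublattices Z of X containing X′ such that Z is uniformly complete as a vector lattice in its own right. If T(X′) ⊆ Y′, then T(X̄′) ⊆ Y′. -/

import Mathlib

open scoped BigOperators

/-- A continuous function `ℝⁿ → ℝ` of polynomial growth (an element of `PG_n`). -/
def PolyGrowth (n : ℕ) (f : (Fin n → ℝ) → ℝ) : Prop :=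
  Continuous f ∧ ∃ (M : ℝ) (N : ℕ), 0 ≤ M ∧
    ∀ t : Fin n → ℝ, |f t| ≤ M * (1 + ∑ i : Fin n, |t i|) ^ N

/-- An element of `PG_n^h`: a polynomial growth continuous function `f` such that
`f (t • x) / t` converges as `t → 0⁺`, uniformly in `x` on every bounded set. -/
def PolyGrowthH (n : ℕ) (f : (Fin n → ℝ) → ℝ) : Prop :=
  PolyGrowth n f ∧ ∃ fh : (Fin n → ℝ) → ℝ,
    ∀ B : Set (Fin n → ℝ), Bornology.IsBounded B →
      ∀ ε : ℝ, 0 < ε → ∃ δ : ℝ, 0 < δ ∧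
        ∀ t : ℝ, 0 < t → t < δ → ∀ y ∈ B, |f (t • y) / t - fh y| < ε

/-- An element of `H_n`: a continuous positively homogeneous function `ℝⁿ → ℝ`. -/
def PosHomog (n : ℕ) (f : (Fin n → ℝ) → ℝ) : Prop :=
  Continuous f ∧ ∀ (c : ℝ), 0 ≤ c → ∀ t : Fin n → ℝ, f (c • t) = c * f t

section Defs

variable {X : Type*} [Lattice X] [AddCommGroup X] [Module ℝ X]

/-- The order ideal `I_e` generated by `e`. -/
def idealSet (e : X) : Set X := {x : X | ∃ c : ℝ, 0 ≤ c ∧ |x| ≤ c • e}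

/-- The norm `‖x‖_e = inf {c ≥ 0 : |x| ≤ c • e}`. -/
noncomputable def regNorm (e x : X) : ℝ := sInf {c : ℝ | 0 ≤ c ∧ |x| ≤ c • e}

/-- The norm `‖·‖_e` is complete on the set `S`: every `‖·‖_e`-Cauchy sequence in `S`
converges, in `‖·‖_e`, to an element of `S`. -/
def NormComplete (e : X) (S : Set X) : Prop :=
  ∀ u : ℕ → X, (∀ k, u k ∈ S) →
    (∀ ε : ℝ, 0 < ε → ∃ N : ℕ, ∀ p q : ℕ, N ≤ p → N ≤ q → regNorm e (u p - u q) < ε) →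
    ∃ x ∈ S, ∀ ε : ℝ, 0 < ε → ∃ N : ℕ, ∀ p : ℕ, N ≤ p → regNorm e (u p - x) < ε

/-- A uniformly complete vector lattice: `(I_e, ‖·‖_e)` is complete for every `e ≥ 0`. -/
def UniformlyComplete (X : Type*) [Lattice X] [AddCommGroup X] [Module ℝ X] : Prop :=
  ∀ e : X, 0 ≤ e → NormComplete e (idealSet e)

/-- A subset `Z` is uniformly complete as a vector lattice in its own right. -/
def UCSet (Z : Set X) : Prop :=
  ∀ e ∈ Z, 0 ≤ e → NormComplete e (Z ∩ idealSet e)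

/-- A (vector) sublattice: a linear subspace closed under binary suprema. -/
def IsSublatticeSet (Z : Set X) : Prop :=
  (0 ∈ Z) ∧ (∀ a ∈ Z, ∀ b ∈ Z, a + b ∈ Z) ∧ (∀ (c : ℝ), ∀ a ∈ Z, c • a ∈ Z) ∧
  (∀ a ∈ Z, -a ∈ Z) ∧ (∀ a ∈ Z, ∀ b ∈ Z, a ⊔ b ∈ Z) ∧ (∀ a ∈ Z, ∀ b ∈ Z, a ⊓ b ∈ Z)

/-- An order ideal: a linear subspace that is solid. -/
def IsOrderIdealSet (I : Set X) : Prop :=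
  (0 ∈ I) ∧ (∀ a ∈ I, ∀ b ∈ I, a + b ∈ I) ∧ (∀ (c : ℝ), ∀ a ∈ I, c • a ∈ I) ∧
  (∀ a ∈ I, ∀ b : X, |b| ≤ |a| → b ∈ I)

/-- A vector lattice homomorphism defined on the class of functions `ℝⁿ → ℝ`
satisfying the predicate `P` (with pointwise operations), taking values in `X`. -/
def IsLatHom {n : ℕ} (P : ((Fin n → ℝ) → ℝ) → Prop) (Φ : ∀ f, P f → X) : Prop :=
  (∀ (f g : (Fin n → ℝ) → ℝ) (hf : P f) (hg : P g) (hfg : P (f + g)),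
      Φ (f + g) hfg = Φ f hf + Φ g hg) ∧
  (∀ (c : ℝ) (f : (Fin n → ℝ) → ℝ) (hf : P f) (hcf : P (c • f)),
      Φ (c • f) hcf = c • Φ f hf) ∧
  (∀ (f g : (Fin n → ℝ) → ℝ) (hf : P f) (hg : P g) (hfg : P (f ⊔ g)),
      Φ (f ⊔ g) hfg = Φ f hf ⊔ Φ g hg)

end Defs

section MulDefs

variable {X : Type*} [Lattice X] [AddCommGroup X] [Module ℝ X] [Mul X]

/-- A lattice-algebra homomorphism defined on the class of functions `ℝⁿ → ℝ`
satisfying the predicate `P` (with pointwise operations), taking values in `X`. -/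
def IsLatAlgHom {n : ℕ} (P : ((Fin n → ℝ) → ℝ) → Prop) (Ψ : ∀ f, P f → X) : Prop :=
  IsLatHom P Ψ ∧
  (∀ (f g : (Fin n → ℝ) → ℝ) (hf : P f) (hg : P g) (hfg : P (f * g)),
      Ψ (f * g) hfg = Ψ f hf * Ψ g hg)

/-- A sublattice-algebra: a linear subspace that is both a sublattice and a subalgebra. -/
def IsSublatticeAlgebraSet (Z : Set X) : Prop :=
  IsSublatticeSet Z ∧ ∀ a ∈ Z, ∀ b ∈ Z, a * b ∈ Z

/-- The `f`-algebra condition, relativized to a subset. -/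
def IsFAlgebraSet (Z : Set X) : Prop :=
  ∀ a ∈ Z, ∀ b ∈ Z, ∀ z ∈ Z, a ⊓ b = 0 → 0 ≤ z → (z * a) ⊓ b = 0 ∧ (a * z) ⊓ b = 0

/-- An `f`-subalgebra: a sublattice-algebra which is itself an `f`-algebra. -/
def IsFSubalgebra (Z : Set X) : Prop := IsSublatticeAlgebraSet Z ∧ IsFAlgebraSet Z

/-- `powS e m = e^(m+1)`, defined without assuming an identity element. -/
def powS (e : X) : ℕ → X
  | 0 => e
  | m + 1 => powS e m * e

end MulDefs

/-- A map `T : X → A` which is a lattice-algebra homomorphism on a subset `S` of `X`. -/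
def IsLatAlgHomOn {X A : Type*} [Lattice X] [AddCommGroup X] [Module ℝ X] [Mul X]
    [Lattice A] [AddCommGroup A] [Module ℝ A] [Mul A] (S : Set X) (T : X → A) : Prop :=
  (∀ a ∈ S, ∀ b ∈ S, T (a + b) = T a + T b) ∧
  (∀ (c : ℝ), ∀ a ∈ S, T (c • a) = c • T a) ∧
  (∀ a ∈ S, ∀ b ∈ S, T (a ⊔ b) = T a ⊔ T b) ∧
  (∀ a ∈ S, ∀ b ∈ S, T (a * b) = T a * T b)

lemma abs_sup_sub_sup_le_add {X : Type*} [Lattice X] [AddCommGroup X] [IsOrderedAddMonoid X]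
    (a b c d : X) : |a ⊔ b - c ⊔ d| ≤ |a - c| + |b - d| := by
  calc |a ⊔ b - c ⊔ d| = |(a ⊔ b - c ⊔ b) + (c ⊔ b - c ⊔ d)| := by rw [sub_add_sub_cancel]
    _ ≤ |a ⊔ b - c ⊔ b| + |c ⊔ b - c ⊔ d| := abs_add_le _ _
    _ ≤ _ := by
      refine add_le_add (abs_sup_sub_sup_le_abs a c b) ?_
      rw [sup_comm c b, sup_comm c d]
      exact abs_sup_sub_sup_le_abs b d c

section UniformAdherence

variable {X : Type*} [Lattice X] [AddCommGroup X] [Module ℝ X]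

/-- The set of `x` that are relatively uniform limits of elements of `Z`, with regulator in `Z`. -/
def uniformAdherence (Z : Set X) : Set X :=
  {x | ∃ e ∈ Z, 0 ≤ e ∧ ∀ ε : ℝ, 0 < ε → ∃ z ∈ Z, |x - z| ≤ ε • e}

lemma regNorm_le {e x : X} {c : ℝ} (hc : 0 ≤ c) (h : |x| ≤ c • e) : regNorm e x ≤ c :=
  csInf_le ⟨0, fun _ hd => hd.1⟩ ⟨hc, h⟩

lemma isOrderedModule_of_smul_nonneg [IsOrderedAddMonoid X]
    (h : ∀ (c : ℝ) (a : X), 0 ≤ c → 0 ≤ a → 0 ≤ c • a) : IsOrderedModule ℝ X where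
  smul_le_smul_of_nonneg_left c hc a b hab := by
    have := h c (b - a) hc (sub_nonneg.2 hab)
    rwa [smul_sub, sub_nonneg] at this
  smul_le_smul_of_nonneg_right a ha c d hcd := by
    have := h (d - c) a (sub_nonneg.2 hcd) ha
    rwa [sub_smul, sub_nonneg] at this

lemma subset_uniformAdherence {Z : Set X} [IsOrderedAddMonoid X] [IsOrderedModule ℝ X]
    (h0 : 0 ∈ Z) : Z ⊆ uniformAdherence Z :=
  fun x hx => ⟨0, h0, le_rfl, fun ε _ => ⟨x, hx, by simp⟩⟩

lemma abs_real_smul_le [IsOrderedModule ℝ X] (c : ℝ) (a : X) : |c • a| ≤ |c| • |a| := by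
  rcases le_total 0 c with hc | hc
  · rw [abs_of_nonneg hc]
    refine abs_le'.2 ⟨smul_le_smul_of_nonneg_left (le_abs_self a) hc, ?_⟩
    rw [← smul_neg]
    exact smul_le_smul_of_nonneg_left (neg_le_abs a) hc
  · rw [abs_of_nonpos hc]
    refine abs_le'.2 ⟨?_, ?_⟩
    · rw [← neg_smul_neg c a]
      exact smul_le_smul_of_nonneg_left (neg_le_abs a) (neg_nonneg.2 hc)
    · rw [← neg_smul]
      exact smul_le_smul_of_nonneg_left (le_abs_self a) (neg_nonneg.2 hc)

lemma abs_sub_le_add_of_abs_sub_le [IsOrderedAddMonoid X] {e x y z : X} {c d : ℝ}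
    (hx : |x - z| ≤ c • e) (hy : |y - z| ≤ d • e) : |x - y| ≤ (c + d) • e := by
  rw [add_smul]
  calc |x - y| = |(x - z) + (z - y)| := by rw [sub_add_sub_cancel]
    _ ≤ |x - z| + |z - y| := abs_add_le _ _
    _ ≤ _ := add_le_add hx (by rwa [abs_sub_comm])

lemma sub_mem_idealSet [IsOrderedAddMonoid X] {e x y : X}
    (hx : x ∈ idealSet e) (hy : y ∈ idealSet e) :
    x - y ∈ idealSet e := by
  obtain ⟨c, hc, hxc⟩ := hx
  obtain ⟨d, hd, hyd⟩ := hy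
  exact ⟨c + d, add_nonneg hc hd, abs_sub_le_add_of_abs_sub_le (z := 0) (by simpa) (by simpa)⟩

variable [IsOrderedAddMonoid X] [IsOrderedModule ℝ X]

lemma abs_le_smul_of_regNorm_lt {e x : X} {c : ℝ} (he : 0 ≤ e) (hx : x ∈ idealSet e)
    (h : regNorm e x < c) : |x| ≤ c • e := by
  obtain ⟨d, ⟨_, hd⟩, hdc⟩ := exists_lt_of_csInf_lt hx h
  exact hd.trans (smul_le_smul_of_nonneg_right hdc.le he)

lemma eq_of_forall_abs_sub_le_smul
    (harch : ∀ a b : X, 0 ≤ a → 0 ≤ b → (∀ k : ℕ, k • a ≤ b) → a = 0)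
    {e x y : X} (he : 0 ≤ e) (h : ∀ ε : ℝ, 0 < ε → |x - y| ≤ ε • e) : x = y := by
  have h0 : |x - y| = 0 := by
    refine harch _ e (abs_nonneg _) he fun k => ?_
    rcases Nat.eq_zero_or_pos k with rfl | hk
    · simpa using he
    · have hk' : (0 : ℝ) < k := Nat.cast_pos.2 hk
      have := smul_le_smul_of_nonneg_left (h (k : ℝ)⁻¹ (inv_pos.2 hk')) hk'.le
      rwa [smul_inv_smul₀ hk'.ne', Nat.cast_smul_eq_nsmul] at this
  have h1 : x - y ≤ 0 := h0 ▸ le_abs_self (x - y)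
  have h2 : -(x - y) ≤ 0 := h0 ▸ neg_le_abs (x - y)
  exact le_antisymm (sub_nonpos.1 h1) (by rwa [neg_sub, sub_nonpos] at h2)

lemma IsSublatticeSet.uniformAdherence {Z : Set X} (hZ : IsSublatticeSet Z) :
    IsSublatticeSet (uniformAdherence Z) := by
  have ⟨h0, hadd, hsmul, hneg, hsup, _⟩ := hZ
  have hneg' : ∀ a ∈ _root_.uniformAdherence Z, -a ∈ _root_.uniformAdherence Z := by
    rintro a ⟨e, he, he0, ha⟩
    refine ⟨e, he, he0, fun ε hε => ?_⟩
    obtain ⟨z, hz, hza⟩ := ha ε hε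
    exact ⟨-z, hneg z hz, by rwa [neg_sub_neg, abs_sub_comm]⟩
  have hsup' : ∀ a ∈ _root_.uniformAdherence Z, ∀ b ∈ _root_.uniformAdherence Z,
      a ⊔ b ∈ _root_.uniformAdherence Z := by
    rintro a ⟨e, he, he0, ha⟩ b ⟨f, hf, hf0, hb⟩
    refine ⟨e + f, hadd e he f hf, add_nonneg he0 hf0, fun ε hε => ?_⟩
    obtain ⟨z, hz, hza⟩ := ha ε hε
    obtain ⟨w, hw, hwb⟩ := hb ε hε
    refine ⟨z ⊔ w, hsup z hz w hw, (abs_sup_sub_sup_le_add _ _ _ _).trans ?_⟩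
    rw [smul_add]
    exact add_le_add hza hwb
  refine ⟨subset_uniformAdherence h0 h0, ?_, ?_, hneg', hsup', fun a ha b hb => ?_⟩
  · rintro a ⟨e, he, he0, ha⟩ b ⟨f, hf, hf0, hb⟩
    refine ⟨e + f, hadd e he f hf, add_nonneg he0 hf0, fun ε hε => ?_⟩
    obtain ⟨z, hz, hza⟩ := ha ε hε
    obtain ⟨w, hw, hwb⟩ := hb ε hε
    refine ⟨z + w, hadd z hz w hw, ?_⟩
    rw [smul_add, add_sub_add_comm]
    exact (abs_add_le _ _).trans (add_le_add hza hwb)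
  · rintro c a ⟨e, he, he0, ha⟩
    refine ⟨|c| • e, hsmul _ e he, smul_nonneg (abs_nonneg c) he0, fun ε hε => ?_⟩
    obtain ⟨z, hz, hza⟩ := ha ε hε
    refine ⟨c • z, hsmul c z hz, ?_⟩
    rw [← smul_sub, smul_comm]
    exact (abs_real_smul_le _ _).trans (smul_le_smul_of_nonneg_left hza (abs_nonneg c))
  · have := hneg' _ (hsup' _ (hneg' a ha) _ (hneg' b hb))
    rwa [neg_sup, neg_neg, neg_neg] at this

lemma UniformlyComplete.ucSet_of_uniformAdherence_subset (hX : UniformlyComplete X) {Z : Set X}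
    (hZ : uniformAdherence Z ⊆ Z) : UCSet Z := by
  intro e he he0 u hu hcauchy
  obtain ⟨x, hx, hlim⟩ := hX e he0 u (fun k => (hu k).2) hcauchy
  refine ⟨x, ⟨hZ ⟨e, he, he0, fun ε hε => ?_⟩, hx⟩, hlim⟩
  obtain ⟨N, hN⟩ := hlim ε hε
  refine ⟨u N, (hu N).1, ?_⟩
  rw [abs_sub_comm]
  exact abs_le_smul_of_regNorm_lt he0 (sub_mem_idealSet (hu N).2 hx) (hN N le_rfl)

/-- A uniformly complete sublattice is closed under relatively uniform limits. -/
lemma UCSet.uniformAdherence_subset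
    (harch : ∀ a b : X, 0 ≤ a → 0 ≤ b → (∀ k : ℕ, k • a ≤ b) → a = 0)
    {Z : Set X} (hZ : IsSublatticeSet Z) (huc : UCSet Z) : uniformAdherence Z ⊆ Z := by
  rintro x ⟨e, he, he0, hx⟩
  have ⟨_, hadd, _, hneg, _, _⟩ := hZ
  choose z hzZ hz using fun n : ℕ => hx (1 / ((n : ℝ) + 1)) Nat.one_div_pos_of_nat
  have hdist (p q : ℕ) : |z p - z q| ≤ (1 / ((p : ℝ) + 1) + 1 / ((q : ℝ) + 1)) • e :=
    abs_sub_le_add_of_abs_sub_le (z := x) (by rw [abs_sub_comm]; exact hz p)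
      (by rw [abs_sub_comm]; exact hz q)
  have hpos (p q : ℕ) : (0 : ℝ) ≤ 1 / ((p : ℝ) + 1) + 1 / ((q : ℝ) + 1) := by positivity
  have hsmall (ε : ℝ) (hε : 0 < ε) : ∃ N : ℕ, ∀ p : ℕ, N ≤ p → 1 / ((p : ℝ) + 1) < ε := by
    obtain ⟨N, hN⟩ := exists_nat_one_div_lt hε
    exact ⟨N, fun p hp => (Nat.one_div_le_one_div hp).trans_lt hN⟩
  have hu (k : ℕ) : z k - z 0 ∈ Z ∩ idealSet e :=
    ⟨sub_eq_add_neg (z k) (z 0) ▸ hadd _ (hzZ k) _ (hneg _ (hzZ 0)), _, hpos k 0, hdist k 0⟩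
  obtain ⟨w, ⟨hwZ, hwe⟩, hlim⟩ := huc e he he0 (fun k => z k - z 0) hu (by
    intro ε hε
    obtain ⟨N, hN⟩ := hsmall (ε / 2) (half_pos hε)
    refine ⟨N, fun p q hp hq => ?_⟩
    rw [sub_sub_sub_cancel_right]
    refine (regNorm_le (hpos p q) (hdist p q)).trans_lt ?_
    linarith [hN p hp, hN q hq])
  have hxw : x = w + z 0 := by
    refine eq_of_forall_abs_sub_le_smul harch he0 fun ε hε => ?_
    obtain ⟨N, hN⟩ := hsmall (ε / 2) (half_pos hε)
    obtain ⟨M, hM⟩ := hlim (ε / 2) (half_pos hε)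
    have h₁ : |x - z (max N M)| ≤ (ε / 2) • e :=
      (hz _).trans (smul_le_smul_of_nonneg_right (hN _ (le_max_left _ _)).le he0)
    have h₂ := abs_le_smul_of_regNorm_lt he0 (sub_mem_idealSet (hu _).2 hwe)
      (hM _ (le_max_right N M))
    rw [sub_right_comm, sub_sub, abs_sub_comm] at h₂
    simpa using abs_sub_le_add_of_abs_sub_le h₁ h₂
  exact hxw ▸ hadd w hwZ _ (hzZ 0)

end UniformAdherence

/-- A positive linear map preserves relatively uniform limits. -/
lemma mapsTo_uniformAdherence {X Y : Type*} [Lattice X] [AddCommGroup X] [Module ℝ X]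
    [IsOrderedAddMonoid X] [Lattice Y] [AddCommGroup Y] [Module ℝ Y] [IsOrderedAddMonoid Y]
    (T : X →ₗ[ℝ] Y) (hpos : ∀ a : X, 0 ≤ a → 0 ≤ T a) {Z : Set X} {W : Set Y}
    (h : ∀ a ∈ Z, T a ∈ W) : ∀ a ∈ uniformAdherence Z, T a ∈ uniformAdherence W := by
  have hmono (a b : X) (hab : a ≤ b) : T a ≤ T b := by
    have := hpos _ (sub_nonneg.2 hab)
    rwa [map_sub, sub_nonneg] at this
  rintro a ⟨e, he, he0, ha⟩
  refine ⟨T e, h e he, hpos e he0, fun ε hε => ?_⟩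
  obtain ⟨z, hz, hza⟩ := ha ε hε
  refine ⟨T z, h z hz, ?_⟩
  rw [← map_sub, ← map_smul]
  refine abs_le'.2 ⟨hmono _ _ ((le_abs_self _).trans hza), ?_⟩
  rw [← map_neg]
  exact hmono _ _ ((neg_le_abs _).trans hza)

lemma IsSublatticeSet.sUnion_of_isChain {X : Type*} [Lattice X] [AddCommGroup X] [Module ℝ X]
    {c : Set (Set X)} (hc : IsChain (· ⊆ ·) c) (hne : c.Nonempty)
    (h : ∀ Z ∈ c, IsSublatticeSet Z) : IsSublatticeSet (⋃₀ c) := by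
  have hcommon : ∀ a ∈ ⋃₀ c, ∀ b ∈ ⋃₀ c, ∃ Z ∈ c, a ∈ Z ∧ b ∈ Z := by
    rintro a ⟨A, hA, ha⟩ b ⟨B, hB, hb⟩
    rcases hc.total hA hB with hAB | hBA
    · exact ⟨B, hB, hAB ha, hb⟩
    · exact ⟨A, hA, ha, hBA hb⟩
  obtain ⟨Z₀, hZ₀⟩ := hne
  refine ⟨⟨Z₀, hZ₀, (h Z₀ hZ₀).1⟩, fun a ha b hb => ?_, ?_, ?_, fun a ha b hb => ?_,
    fun a ha b hb => ?_⟩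
  · obtain ⟨Z, hZ, haZ, hbZ⟩ := hcommon a ha b hb
    exact ⟨Z, hZ, (h Z hZ).2.1 a haZ b hbZ⟩
  · rintro r a ⟨Z, hZ, ha⟩
    exact ⟨Z, hZ, (h Z hZ).2.2.1 r a ha⟩
  · rintro a ⟨Z, hZ, ha⟩
    exact ⟨Z, hZ, (h Z hZ).2.2.2.1 a ha⟩
  · obtain ⟨Z, hZ, haZ, hbZ⟩ := hcommon a ha b hb
    exact ⟨Z, hZ, (h Z hZ).2.2.2.2.1 a haZ b hbZ⟩
  · obtain ⟨Z, hZ, haZ, hbZ⟩ := hcommon a ha b hb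
    exact ⟨Z, hZ, (h Z hZ).2.2.2.2.2 a haZ b hbZ⟩

/-- Lemma 3.6 / `lem:prelim4`: a positive map sends the uniform closure
of `X′` into a uniformly complete sublattice `Y′` containing `T(X′)`. -/
theorem stmt_11 {X Y : Type*} [Lattice X] [AddCommGroup X] [Module ℝ X]
    [Lattice Y] [AddCommGroup Y] [Module ℝ Y]
    [CovariantClass X X (· + ·) (· ≤ ·)] [CovariantClass Y Y (· + ·) (· ≤ ·)]
    (hsmulposX : ∀ (c : ℝ) (a : X), 0 ≤ c → 0 ≤ a → 0 ≤ c • a)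
    (harchX : ∀ a b : X, 0 ≤ a → 0 ≤ b → (∀ k : ℕ, k • a ≤ b) → a = 0)
    (hsmulposY : ∀ (c : ℝ) (a : Y), 0 ≤ c → 0 ≤ a → 0 ≤ c • a)
    (harchY : ∀ a b : Y, 0 ≤ a → 0 ≤ b → (∀ k : ℕ, k • a ≤ b) → a = 0)
    (hucX : UniformlyComplete X)
    (T : X → Y)
    (hadd : ∀ a b : X, T (a + b) = T a + T b)
    (hsmul : ∀ (c : ℝ) (a : X), T (c • a) = c • T a)
    (hpos : ∀ a : X, 0 ≤ a → 0 ≤ T a)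
    (X' : Set X) (Y' : Set Y)
    (hX' : IsSublatticeSet X') (hY' : IsSublatticeSet Y') (hY'uc : UCSet Y')
    (hTX' : ∀ a ∈ X', T a ∈ Y') :
    ∀ a ∈ ⋂₀ {Z : Set X | IsSublatticeSet Z ∧ X' ⊆ Z ∧ UCSet Z}, T a ∈ Y' := by
  have : IsOrderedAddMonoid X :=
    { add_le_add_left := fun _ _ h c => by
        rw [add_comm _ c, add_comm _ c]; exact CovariantClass.elim c h }
  have : IsOrderedAddMonoid Y :=
    { add_le_add_left := fun _ _ h c => by
        rw [add_comm _ c, add_comm _ c]; exact CovariantClass.elim c h }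
  have := isOrderedModule_of_smul_nonneg hsmulposX
  have := isOrderedModule_of_smul_nonneg hsmulposY
  let L : X →ₗ[ℝ] Y := { toFun := T, map_add' := hadd, map_smul' := hsmul }
  obtain ⟨Z, hX'Z, hmax⟩ := zorn_subset_nonempty
    {Z : Set X | IsSublatticeSet Z ∧ ∀ a ∈ Z, T a ∈ Y'}
    (fun c hcS hc hne => ⟨⋃₀ c,
      ⟨IsSublatticeSet.sUnion_of_isChain hc hne fun Z hZ => (hcS hZ).1,
        fun a ⟨Z, hZ, ha⟩ => (hcS hZ).2 a ha⟩,
      fun _ => Set.subset_sUnion_of_mem⟩) X' ⟨hX', hTX'⟩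
  obtain ⟨hZ, hTZ⟩ := hmax.prop
  have hadh : uniformAdherence Z ⊆ Z :=
    hmax.le_of_ge ⟨hZ.uniformAdherence, fun a ha =>
      hY'uc.uniformAdherence_subset harchY hY' (mapsTo_uniformAdherence L hpos hTZ a ha)⟩
      (subset_uniformAdherence hZ.1)
  exact fun a ha => hTZ a (ha Z ⟨hZ, hX'Z, hucX.ucSet_of_uniformAdherence_subset hadh⟩)
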